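/- arXiv:2211.15314 — 6 statements merged into one kernel-verified Lean document; each statement's English description precedes it below -/
import Mathlib

section
/- Let G be a simple graph on n vertices with vertex set V, let {S1, S2, S3} be a partition of V with S1 ∪ S2 nonempty, and let p be the vector indexed by V with p_v = 1 for v ∈ S1, p_v = −1 for v ∈ S2, and p_v = 0 for v ∈ S3. Then p is an eigenvector of the signless Laplacian Q(G) = D(G) + A(G) to the eigenvalue q if and only if: 2·d_v(S1) + d_v(S1,S3) = q for every v ∈ S1; 2·d_v(S2) + d_v(S2,S3) = q for every v ∈ S2; and d_v(S3,S1) = d_v(S3,S2) for every v ∈ S3. -/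
open Finset

/-- Number of neighbors of `v` (in graph `G`) lying in the set `X`. -/
def degIn {n : ℕ} (G : SimpleGraph (Fin n)) [DecidableRel G.Adj]
    (v : Fin n) (X : Finset (Fin n)) : ℕ :=
  (X.filter fun u => G.Adj v u).card

/-- The signless Laplacian matrix `Q(G) = D(G) + A(G)`. -/
def signlessLap {n : ℕ} (G : SimpleGraph (Fin n)) [DecidableRel G.Adj] :
    Matrix (Fin n) (Fin n) ℝ :=
  Matrix.diagonal (fun v => (G.degree v : ℝ)) + G.adjMatrix ℝ

theorem degIn_eq_sum {n : ℕ} (G : SimpleGraph (Fin n)) [DecidableRel G.Adj]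
    (v : Fin n) (X : Finset (Fin n)) :
    (degIn G v X : ℝ) = ∑ u ∈ X, G.adjMatrix ℝ v u := by
  simp [degIn, SimpleGraph.adjMatrix_apply]

theorem degIn_univ {n : ℕ} (G : SimpleGraph (Fin n)) [DecidableRel G.Adj] (v : Fin n) :
    degIn G v Finset.univ = G.degree v := by
  rw [degIn, ← G.card_neighborFinset_eq_degree, G.neighborFinset_eq_filter]

theorem degIn_union {n : ℕ} (G : SimpleGraph (Fin n)) [DecidableRel G.Adj]
    (v : Fin n) {X Y : Finset (Fin n)} (h : Disjoint X Y) :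
    degIn G v (X ∪ Y) = degIn G v X + degIn G v Y := by
  rw [degIn, Finset.filter_union, Finset.card_union_of_disjoint (Finset.disjoint_filter_filter h)]
  rfl

theorem signlessLap_mulVec_apply {n : ℕ} (G : SimpleGraph (Fin n)) [DecidableRel G.Adj]
    (p : Fin n → ℝ) (v : Fin n) :
    (signlessLap G).mulVec p v = G.degree v * p v + ∑ u, G.adjMatrix ℝ v u * p u := by
  simp only [signlessLap, Matrix.add_mulVec, Pi.add_apply, Matrix.mulVec_diagonal]
  rfl

theorem sum_adjMatrix_mul_sign {n : ℕ} (G : SimpleGraph (Fin n)) [DecidableRel G.Adj]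
    {S T : Finset (Fin n)} (h : Disjoint S T) (v : Fin n) :
    ∑ u, G.adjMatrix ℝ v u * (if u ∈ S then 1 else if u ∈ T then -1 else 0) =
      (degIn G v S : ℝ) - degIn G v T := by
  have hsign (u : Fin n) : (if u ∈ S then (1 : ℝ) else if u ∈ T then -1 else 0) =
      (if u ∈ S then 1 else 0) - (if u ∈ T then 1 else 0) := by
    have : u ∈ S → u ∉ T := fun hu => Finset.disjoint_left.mp h hu
    split_ifs <;> simp_all
  simp only [hsign, mul_sub, Finset.sum_sub_distrib, mul_ite, mul_one, mul_zero,
    Finset.sum_ite_mem, Finset.univ_inter, degIn_eq_sum]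

theorem stmt_3 {n : ℕ} (G : SimpleGraph (Fin n)) [DecidableRel G.Adj]
    (S1 S2 S3 : Finset (Fin n))
    (h12 : Disjoint S1 S2) (h13 : Disjoint S1 S3) (h23 : Disjoint S2 S3)
    (hcover : S1 ∪ S2 ∪ S3 = Finset.univ)
    (hne : (S1 ∪ S2).Nonempty)
    (p : Fin n → ℝ)
    (hp : ∀ v, p v = if v ∈ S1 then 1 else if v ∈ S2 then -1 else 0)
    (q : ℝ) :
    (p ≠ 0 ∧ (signlessLap G).mulVec p = q • p) ↔
      ((∀ v ∈ S1, 2 * (degIn G v S1 : ℝ) + (degIn G v S3 : ℝ) = q) ∧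
       (∀ v ∈ S2, 2 * (degIn G v S2 : ℝ) + (degIn G v S3 : ℝ) = q) ∧
       (∀ v ∈ S3, degIn G v S1 = degIn G v S2)) := by
  have hp0 : p ≠ 0 := by
    obtain ⟨v, hv⟩ := hne
    intro h0
    have hpv := hp v
    rw [h0, Pi.zero_apply] at hpv
    rcases Finset.mem_union.mp hv with h | h
    · simp [h] at hpv
    · simp [h, Finset.disjoint_right.mp h12 h] at hpv
  have hdeg (v : Fin n) : (G.degree v : ℝ) = degIn G v S1 + degIn G v S2 + degIn G v S3 := by
    rw [← degIn_univ, ← hcover,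
      degIn_union G v (Finset.disjoint_union_left.mpr ⟨h13, h23⟩), degIn_union G v h12]
    push_cast
    rfl
  have hQ (v : Fin n) : (signlessLap G).mulVec p v =
      (degIn G v S1 + degIn G v S2 + degIn G v S3) * p v + (degIn G v S1 - degIn G v S2) := by
    rw [signlessLap_mulVec_apply, hdeg, ← sum_adjMatrix_mul_sign G h12]
    simp only [← hp]
  have hp1 : ∀ v ∈ S1, p v = 1 := fun v hv => by simp [hp, hv]
  have hp2 : ∀ v ∈ S2, p v = -1 := fun v hv => by
    simp [hp, hv, Finset.disjoint_right.mp h12 hv]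
  have hp3 : ∀ v ∈ S3, p v = 0 := fun v hv => by
    simp [hp, Finset.disjoint_right.mp h13 hv, Finset.disjoint_right.mp h23 hv]
  simp only [hp0, ne_eq, not_false_eq_true, true_and, funext_iff, hQ, Pi.smul_apply, smul_eq_mul]
  constructor
  · intro h
    refine ⟨fun v hv => ?_, fun v hv => ?_, fun v hv => ?_⟩
    · have := h v
      rw [hp1 v hv] at this
      linarith
    · have := h v
      rw [hp2 v hv] at this
      linarith
    · have := h v
      rw [hp3 v hv] at this
      exact_mod_cast (by linarith : (degIn G v S1 : ℝ) = degIn G v S2)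
  · rintro ⟨h1, h2, h3⟩ v
    have hv : v ∈ S1 ∪ S2 ∪ S3 := hcover ▸ Finset.mem_univ v
    simp only [Finset.mem_union] at hv
    rcases hv with (hv | hv) | hv
    · rw [hp1 v hv]
      linarith [h1 v hv]
    · rw [hp2 v hv]
      linarith [h2 v hv]
    · rw [hp3 v hv, h3 v hv]
      ring
end

section
/- Let G be a simple graph on n ≥ 1 vertices with vertex set V, let c1, c2 be positive real numbers, let {S, S̄} be a bipartition of V, and let p be the vector indexed by V with p_v = c1 for v ∈ S and p_v = −c2 for v ∈ S̄. Then p is an eigenvector of the Laplacian L(G) = D(G) − A(G) to the eigenvalue μ if and only if: (c1 + c2)·d_v(S,S̄) = c1·μ for every v ∈ S, and (c1 + c2)·d_v(S̄,S) = c2·μ for every v ∈ S̄. -/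
open Finset

/-- The Laplacian matrix `L(G) = D(G) - A(G)`. -/
def lap {n : ℕ} (G : SimpleGraph (Fin n)) [DecidableRel G.Adj] :
    Matrix (Fin n) (Fin n) ℝ :=
  Matrix.diagonal (fun v => (G.degree v : ℝ)) - G.adjMatrix ℝ

lemma lap_mulVec_apply {n : ℕ} (G : SimpleGraph (Fin n)) [DecidableRel G.Adj]
    (p : Fin n → ℝ) (v : Fin n) :
    (lap G).mulVec p v = ∑ u ∈ G.neighborFinset v, (p v - p u) := by
  rw [lap, Matrix.sub_mulVec, Pi.sub_apply, Matrix.mulVec_diagonal,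
    SimpleGraph.adjMatrix_mulVec_apply, Finset.sum_sub_distrib, Finset.sum_const, nsmul_eq_mul,
    SimpleGraph.card_neighborFinset_eq_degree]

lemma mul_degIn_eq_sum {n : ℕ} (G : SimpleGraph (Fin n)) [DecidableRel G.Adj]
    (v : Fin n) (X : Finset (Fin n)) (c : ℝ) :
    c * (degIn G v X : ℝ) = ∑ u ∈ G.neighborFinset v, if u ∈ X then c else 0 := by
  have h : (X.filter fun u => G.Adj v u) = (G.neighborFinset v).filter (· ∈ X) := by
    ext u
    simp [and_comm]
  rw [← Finset.sum_filter, Finset.sum_const, nsmul_eq_mul, degIn, h, mul_comm]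

theorem stmt_7 {n : ℕ} (hn : 1 ≤ n) (G : SimpleGraph (Fin n)) [DecidableRel G.Adj]
    (c1 c2 : ℝ) (hc1 : 0 < c1) (hc2 : 0 < c2)
    (S : Finset (Fin n))
    (p : Fin n → ℝ)
    (hp : ∀ v, p v = if v ∈ S then c1 else -c2)
    (mu : ℝ) :
    (p ≠ 0 ∧ (lap G).mulVec p = mu • p) ↔
      ((∀ v ∈ S, (c1 + c2) * (degIn G v Sᶜ : ℝ) = c1 * mu) ∧
       (∀ v ∈ Sᶜ, (c1 + c2) * (degIn G v S : ℝ) = c2 * mu)) := by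
  have hp0 : p ≠ 0 := by
    intro h
    have h0 := hp ⟨0, hn⟩
    rw [h, Pi.zero_apply] at h0
    split_ifs at h0 <;> linarith
  have hS : ∀ v ∈ S, (lap G).mulVec p v = (c1 + c2) * (degIn G v Sᶜ : ℝ) := by
    intro v hv
    rw [lap_mulVec_apply, mul_degIn_eq_sum]
    refine Finset.sum_congr rfl fun u _ => ?_
    by_cases hu : u ∈ S <;> simp [hp, hv, hu]
  have hSc : ∀ v ∈ Sᶜ, (lap G).mulVec p v = -((c1 + c2) * (degIn G v S : ℝ)) := by
    intro v hv
    rw [Finset.mem_compl] at hv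
    rw [lap_mulVec_apply, mul_degIn_eq_sum, ← Finset.sum_neg_distrib]
    refine Finset.sum_congr rfl fun u _ => ?_
    by_cases hu : u ∈ S <;> simp [hp, hv, hu]
    ring
  rw [and_iff_right hp0]
  constructor
  · intro h
    refine ⟨fun v hv => ?_, fun v hv => ?_⟩
    · rw [← hS v hv, h, Pi.smul_apply, smul_eq_mul, hp, if_pos hv, mul_comm]
    · have hv' := hSc v hv
      rw [h, Pi.smul_apply, smul_eq_mul, hp, if_neg (Finset.mem_compl.mp hv)] at hv'
      linarith
  · rintro ⟨h1, h2⟩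
    ext v
    rw [Pi.smul_apply, smul_eq_mul, hp]
    by_cases hv : v ∈ S
    · rw [hS v hv, h1 v hv, if_pos hv, mul_comm]
    · rw [hSc v (Finset.mem_compl.mpr hv), h2 v (Finset.mem_compl.mpr hv), if_neg hv]
      ring
end

section
/- Let A be a real symmetric matrix of order n ≥ 1, let k ≥ 2, let 𝒱 = {V_1, ..., V_k} be a partition of {1, ..., n} into k parts, and let B be a real diagonal matrix of order n. Then the largest eigenvalue of B − A satisfies λ_1(B − A) ≥ (2k/((k−1)n))·cut(A,𝒱) − (ΣA)/n + (ΣB)/n. -/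
open Finset

/-- The quadratic form of a real Hermitian matrix is bounded by any upper bound of its
eigenvalues times the squared norm. -/
theorem Matrix.IsHermitian.dotProduct_mulVec_le {ι : Type*} [Fintype ι] [DecidableEq ι]
    {M : Matrix ι ι ℝ} (hM : M.IsHermitian) {c : ℝ} (hc : ∀ i, hM.eigenvalues i ≤ c)
    (x : ι → ℝ) : x ⬝ᵥ M.mulVec x ≤ c * (x ⬝ᵥ x) := by
  have hpos : (c • (1 : Matrix ι ι ℝ) - M).PosSemidef := by
    have hU : (hM.eigenvectorUnitary : Matrix ι ι ℝ) * star (hM.eigenvectorUnitary : Matrix ι ι ℝ)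
        = 1 := Unitary.coe_mul_star_self _
    have hD : (Matrix.diagonal fun i => c - hM.eigenvalues i).PosSemidef :=
      Matrix.PosSemidef.diagonal fun i => sub_nonneg.mpr (hc i)
    have h := hD.mul_mul_conjTranspose_same (hM.eigenvectorUnitary : Matrix ι ι ℝ)
    convert h using 1
    have hs := hM.spectral_theorem
    rw [Unitary.conjStarAlgAut_apply] at hs
    have hd : (Matrix.diagonal fun i => c - hM.eigenvalues i)
        = c • (1 : Matrix ι ι ℝ) - Matrix.diagonal (RCLike.ofReal ∘ hM.eigenvalues) := by
      ext i j
      by_cases hij : i = j <;> simp [hij]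
    rw [hd, Matrix.mul_sub, Matrix.sub_mul, ← Matrix.star_eq_conjTranspose, ← hs]
    simp [hU]
  have h := hpos.dotProduct_mulVec_nonneg x
  simpa [Matrix.sub_mulVec, Matrix.smul_mulVec, dotProduct_sub] using h

theorem sum_indicator_eq_one {ι κ : Type*} [Fintype κ] [DecidableEq ι] {V : κ → Finset ι}
    (hdisj : ∀ i j, i ≠ j → Disjoint (V i) (V j)) (hcover : ∀ x, ∃ i, x ∈ V i) (x : ι) :
    ∑ p, (if x ∈ V p then (1 : ℝ) else 0) = 1 := by
  obtain ⟨q, hq⟩ := hcover x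
  rw [Finset.sum_eq_single q]
  · simp [hq]
  · intro p _ hpq
    simp [Finset.disjoint_left.mp (hdisj q p hpq.symm) hq]
  · simp

/-- Summing the quadratic form over the vectors `k • 𝟙_{V p} - 𝟙`. -/
theorem sum_dotProduct_mulVec_partition {ι : Type*} [Fintype ι] [DecidableEq ι] {k : ℕ}
    {V : Fin k → Finset ι}
    (hdisj : ∀ i j, i ≠ j → Disjoint (V i) (V j)) (hcover : ∀ x, ∃ i, x ∈ V i)
    (M : Matrix ι ι ℝ) :
    ∑ p, (fun i => k * (if i ∈ V p then (1 : ℝ) else 0) - 1) ⬝ᵥ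
        M.mulVec (fun i => k * (if i ∈ V p then (1 : ℝ) else 0) - 1)
      = k ^ 2 * ∑ p, ∑ i ∈ V p, ∑ j ∈ V p, M i j - k * ∑ i, ∑ j, M i j := by
  have hin : ∑ p, ∑ i ∈ V p, ∑ j ∈ V p, M i j
      = ∑ i, ∑ j, ∑ p, (if i ∈ V p then (1 : ℝ) else 0) * (if j ∈ V p then 1 else 0) * M i j := by
    have h : ∀ p, ∑ i ∈ V p, ∑ j ∈ V p, M i j
        = ∑ i, ∑ j, (if i ∈ V p then (1 : ℝ) else 0) * (if j ∈ V p then 1 else 0) * M i j := by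
      intro p
      simp only [mul_assoc, ← Finset.mul_sum]
      simp only [ite_mul, one_mul, zero_mul, Finset.sum_ite_mem, Finset.univ_inter]
    simp_rw [h]
    rw [Finset.sum_comm]
    exact Finset.sum_congr rfl fun i _ => Finset.sum_comm
  simp only [dotProduct, Matrix.mulVec, Finset.mul_sum]
  rw [Finset.sum_comm]
  simp_rw [Finset.sum_comm (s := (univ : Finset (Fin k))) (t := (univ : Finset ι))]
  simp only [← Finset.mul_sum]
  rw [hin]
  simp only [Finset.mul_sum, ← Finset.sum_sub_distrib]
  refine Finset.sum_congr rfl fun i _ => Finset.sum_congr rfl fun j _ => ?_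
  have hi := sum_indicator_eq_one hdisj hcover i
  have hj := sum_indicator_eq_one hdisj hcover j
  calc _ = ∑ p, ((k : ℝ) ^ 2 *
          ((if i ∈ V p then (1 : ℝ) else 0) * (if j ∈ V p then 1 else 0) * M i j)
        - k * M i j * (if i ∈ V p then (1 : ℝ) else 0)
        - k * M i j * (if j ∈ V p then (1 : ℝ) else 0) + M i j) :=
        Finset.sum_congr rfl fun p _ => by ring
    _ = _ := by
        rw [Finset.sum_add_distrib, Finset.sum_sub_distrib, Finset.sum_sub_distrib,
          ← Finset.mul_sum (a := k * M i j), ← Finset.mul_sum (a := k * M i j), hi, hj]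
        simp

theorem Matrix.IsDiag.sum_partition {ι κ : Type*} [Fintype ι] [Fintype κ] [DecidableEq ι]
    {V : κ → Finset ι}
    (hdisj : ∀ i j, i ≠ j → Disjoint (V i) (V j)) (hcover : ∀ x, ∃ i, x ∈ V i)
    {B : Matrix ι ι ℝ} (hB : B.IsDiag) :
    ∑ p, ∑ i ∈ V p, ∑ j ∈ V p, B i j = ∑ i, ∑ j, B i j := by
  have hrow : ∀ i, ∑ j, B i j = B i i := fun i =>
    Finset.sum_eq_single (M := ℝ) i (fun j _ hj => hB hj.symm) (by simp)
  have hblock : ∀ p, ∑ i ∈ V p, ∑ j ∈ V p, B i j = ∑ i, (if i ∈ V p then 1 else 0) * B i i := by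
    intro p
    simp only [ite_mul, one_mul, zero_mul, Finset.sum_ite_mem, Finset.univ_inter]
    refine Finset.sum_congr rfl fun i hi => ?_
    exact Finset.sum_eq_single i (fun j _ hj => hB hj.symm) (fun h => absurd hi h)
  simp_rw [hrow, hblock]
  rw [Finset.sum_comm]
  simp [← Finset.sum_mul, sum_indicator_eq_one hdisj hcover, -ite_mul, -Finset.sum_boole]

theorem stmt_8 {n k : ℕ} (hn : 1 ≤ n) (hk : 2 ≤ k)
    (A B : Matrix (Fin n) (Fin n) ℝ)
    (hA : A.IsSymm) (hB : B.IsDiag)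
    (V : Fin k → Finset (Fin n))
    (hdisj : ∀ i j, i ≠ j → Disjoint (V i) (V j))
    (hcover : ∀ x, ∃ i, x ∈ V i)
    (cutA : ℝ)
    (hcut : 2 * cutA =
      (∑ i, ∑ j, A i j) - ∑ p : Fin k, ∑ i ∈ V p, ∑ j ∈ V p, A i j)
    (hH : (B - A).IsHermitian) :
    (2 * (k : ℝ) / (((k : ℝ) - 1) * n)) * cutA
        - (∑ i, ∑ j, A i j) / n + (∑ i, ∑ j, B i j) / n
      ≤ Finset.univ.sup' (Finset.univ_nonempty_iff.mpr ⟨⟨0, hn⟩⟩) hH.eigenvalues := by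
  set c := Finset.univ.sup' (Finset.univ_nonempty_iff.mpr ⟨⟨0, hn⟩⟩) hH.eigenvalues
  have hc : ∀ i, hH.eigenvalues i ≤ c := fun i => Finset.le_sup' _ (Finset.mem_univ i)
  have hle := Finset.sum_le_sum fun p (_ : p ∈ (univ : Finset (Fin k))) =>
    hH.dotProduct_mulVec_le hc fun i => k * (if i ∈ V p then (1 : ℝ) else 0) - 1
  have hone := sum_dotProduct_mulVec_partition hdisj hcover (1 : Matrix (Fin n) (Fin n) ℝ)
  rw [Matrix.IsDiag.sum_partition hdisj hcover Matrix.isDiag_one] at hone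
  simp only [Matrix.one_mulVec] at hone
  rw [← Finset.mul_sum, hone, sum_dotProduct_mulVec_partition hdisj hcover] at hle
  simp only [Matrix.sub_apply, Finset.sum_sub_distrib, hB.sum_partition hdisj hcover] at hle
  have hn1 : ∑ i : Fin n, ∑ j : Fin n, (1 : Matrix (Fin n) (Fin n) ℝ) i j = n := by
    simp [Matrix.one_apply]
  rw [hn1] at hle
  have hk1 : (0 : ℝ) < k - 1 := by
    have : (2 : ℝ) ≤ k := by exact_mod_cast hk
    linarith
  have hk0 : (0 : ℝ) < k := by linarith
  have hn0 : (0 : ℝ) < n := by exact_mod_cast hn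
  have hin : ∑ p : Fin k, ∑ i ∈ V p, ∑ j ∈ V p, A i j = (∑ i, ∑ j, A i j) - 2 * cutA := by
    linarith
  rw [hin] at hle
  generalize (∑ i, ∑ j, A i j) = a at *
  generalize (∑ i, ∑ j, B i j) = b at *
  have hlhs : 2 * (k : ℝ) / ((k - 1) * n) * cutA - a / n + b / n
      = (k ^ 2 * (b - (a - 2 * cutA)) - k * (b - a)) / (k * (k - 1) * n) := by
    field_simp
    ring
  rw [hlhs, div_le_iff₀ (by positivity)]
  linarith
end

section
/- Let G be a simple graph of order n ≥ 1 and size m, let k ≥ 2, and let λ_n(G) denote the smallest eigenvalue of the adjacency matrix of G. Then the maximum k-cut of G satisfies mc_k(G) ≤ ((k−1)/k)·(m − n·λ_n(G)/2). -/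
open Finset

/-- The maximum `k`-cut of `G`: the maximum, over all partitions of the vertex set
into `k` (possibly empty) parts, of the number of edges joining distinct parts. -/
def maxKCut {n : ℕ} (G : SimpleGraph (Fin n)) [DecidableRel G.Adj] (k : ℕ) : ℕ :=
  Finset.univ.sup fun f : Fin n → Fin k =>
    (G.edgeFinset.filter fun e => ¬ (e.map f).IsDiag).card

theorem SimpleGraph.sum_adj_eq_two_mul_card_edgeFinset {V : Type*} [Fintype V]
    (G : SimpleGraph V) [DecidableRel G.Adj] [Fintype G.edgeSet] :
    ∑ u, ∑ v, (if G.Adj u v then (1 : ℝ) else 0) = 2 * (#G.edgeFinset : ℝ) := by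
  classical
  have h := G.sum_degrees_eq_twice_card_edges
  have h' : ((∑ v, G.degree v : ℕ) : ℝ) = 2 * (#G.edgeFinset : ℝ) := by
    convert congrArg (Nat.cast : ℕ → ℝ) h using 1
    push_cast
    congr!
  rw [← h', Nat.cast_sum]
  refine Finset.sum_congr rfl fun u _ => ?_
  rw [Finset.sum_boole, ← G.card_neighborFinset_eq_degree, G.neighborFinset_eq_filter]

/-- The number of edges joining distinct classes of `f`, counted as a sum over ordered pairs. -/
theorem SimpleGraph.sum_adj_and_ne_eq_two_mul_card {V W : Type*} [Fintype V] [DecidableEq V]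
    [DecidableEq W] (G : SimpleGraph V) [DecidableRel G.Adj] (f : V → W) :
    ∑ u, ∑ v, (if G.Adj u v ∧ f u ≠ f v then (1 : ℝ) else 0) =
      2 * (#(G.edgeFinset.filter fun e => ¬ (e.map f).IsDiag) : ℝ) := by
  let H : SimpleGraph V :=
    { Adj := fun u v => G.Adj u v ∧ f u ≠ f v
      symm := ⟨fun u v h => ⟨h.1.symm, h.2.symm⟩⟩
      loopless := ⟨fun u h => h.2 rfl⟩ }
  let : DecidableRel H.Adj := fun u v => inferInstanceAs (Decidable (G.Adj u v ∧ f u ≠ f v))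
  have hE : H.edgeFinset = G.edgeFinset.filter fun e => ¬ (e.map f).IsDiag := by
    ext e
    induction e with
    | _ u v => simp [H]
  rw [← hE]
  exact H.sum_adj_eq_two_mul_card_edgeFinset

/-- The Rayleigh bound: a lower bound on the eigenvalues bounds the quadratic form below. -/
theorem Matrix.IsHermitian.mul_dotProduct_le_of_le_eigenvalues {ι : Type*} [Fintype ι]
    [DecidableEq ι] {A : Matrix ι ι ℝ} (hA : A.IsHermitian) {c : ℝ}
    (hc : ∀ i, c ≤ hA.eigenvalues i) (x : ι → ℝ) :
    c * (x ⬝ᵥ x) ≤ x ⬝ᵥ A.mulVec x := by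
  let b := hA.eigenvectorBasis
  have key (i : ι) : inner ℝ (b i) (WithLp.toLp 2 (A.mulVec x)) =
      hA.eigenvalues i * inner ℝ (b i) (WithLp.toLp 2 x) := by
    have h := hA.mulVec_eigenvectorBasis i
    have hT : A.transpose = A := by simpa using hA.eq
    simp only [EuclideanSpace.inner_eq_star_dotProduct, star_trivial]
    rw [dotProduct_comm, Matrix.dotProduct_mulVec, ← Matrix.mulVec_transpose, hT, h,
      smul_dotProduct, smul_eq_mul, dotProduct_comm]
  have h₁ (y : ι → ℝ) : x ⬝ᵥ y = ∑ i, inner ℝ (b i) (WithLp.toLp 2 x) *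
      inner ℝ (b i) (WithLp.toLp 2 y) := by
    have h := b.sum_inner_mul_inner (WithLp.toLp 2 x) (WithLp.toLp 2 y)
    rw [EuclideanSpace.inner_eq_star_dotProduct, star_trivial, dotProduct_comm] at h
    rw [← h]
    exact Finset.sum_congr rfl fun i _ => by rw [real_inner_comm]
  rw [h₁ x, h₁ (A.mulVec x), Finset.mul_sum]
  refine Finset.sum_le_sum fun i _ => ?_
  rw [key i]
  nlinarith [mul_le_mul_of_nonneg_right (hc i)
    (mul_self_nonneg (inner ℝ (b i) (WithLp.toLp 2 x)))]

theorem sum_indicator_sub_mul_indicator_sub {W : Type*} [Fintype W] [DecidableEq W] [Nonempty W]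
    (a b : W) :
    ∑ i, ((if a = i then (1 : ℝ) else 0) - 1 / Fintype.card W) *
      ((if b = i then (1 : ℝ) else 0) - 1 / Fintype.card W) =
      (if a = b then 1 else 0) - 1 / Fintype.card W := by
  have hW : (Fintype.card W : ℝ) ≠ 0 := by exact_mod_cast Fintype.card_ne_zero
  simp only [sub_mul, mul_sub, Finset.sum_sub_distrib, ite_mul, mul_ite, one_mul, mul_one,
    zero_mul, mul_zero, Finset.sum_ite_eq, Finset.mem_univ, if_true, Finset.sum_const,
    Finset.card_univ, nsmul_eq_mul]
  field_simp
  ring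

theorem stmt_9 {n : ℕ} (hn : 1 ≤ n) (G : SimpleGraph (Fin n)) [DecidableRel G.Adj]
    (k : ℕ) (hk : 2 ≤ k)
    (hA : (G.adjMatrix ℝ).IsHermitian) :
    (maxKCut G k : ℝ) ≤ (((k : ℝ) - 1) / k) *
      ((G.edgeFinset.card : ℝ)
        - (n : ℝ) * (Finset.univ.inf' (Finset.univ_nonempty_iff.mpr ⟨⟨0, hn⟩⟩)
            hA.eigenvalues) / 2) := by
  unfold maxKCut
  have hk0 : (0 : ℝ) < k := by exact_mod_cast (by omega : 0 < k)
  have : Nonempty (Fin k) := ⟨⟨0, by omega⟩⟩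
  set c := Finset.univ.inf' (Finset.univ_nonempty_iff.mpr ⟨⟨0, hn⟩⟩) hA.eigenvalues
  have hc : ∀ i, c ≤ hA.eigenvalues i := fun i => Finset.inf'_le _ (Finset.mem_univ i)
  obtain ⟨f, -, hf⟩ := Finset.exists_mem_eq_sup (Finset.univ : Finset (Fin n → Fin k))
    Finset.univ_nonempty
    fun f : Fin n → Fin k => (G.edgeFinset.filter fun e : Sym2 (Fin n) => ¬ (e.map f).IsDiag).card
  rw [hf]
  let x : Fin k → Fin n → ℝ := fun i v => (if f v = i then 1 else 0) - 1 / k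
  have hx (u v : Fin n) : ∑ i, x i u * x i v = (if f u = f v then 1 else 0) - 1 / k := by
    simpa [x] using sum_indicator_sub_mul_indicator_sub (f u) (f v)
  have hle := Finset.sum_le_sum fun i (_ : i ∈ (Finset.univ : Finset (Fin k))) =>
    hA.mul_dotProduct_le_of_le_eigenvalues hc (x i)
  have hl : ∑ i, c * (x i ⬝ᵥ x i) = c * (n * (1 - 1 / k)) := by
    simp only [dotProduct]
    rw [← Finset.mul_sum, Finset.sum_comm]
    simp [hx, mul_sub]
  have hr : ∑ i, x i ⬝ᵥ (G.adjMatrix ℝ).mulVec (x i) =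
      (1 - 1 / k) * (2 * (#G.edgeFinset : ℝ)) -
        2 * (#(G.edgeFinset.filter fun e => ¬ (e.map f).IsDiag) : ℝ) := by
    rw [← G.sum_adj_and_ne_eq_two_mul_card f, ← G.sum_adj_eq_two_mul_card_edgeFinset]
    simp only [dotProduct, Matrix.mulVec, Finset.mul_sum, ← Finset.sum_sub_distrib]
    rw [Finset.sum_comm]
    refine Finset.sum_congr rfl fun u _ => ?_
    rw [Finset.sum_comm]
    refine Finset.sum_congr rfl fun v _ => ?_
    have : ∑ i, x i u * (G.adjMatrix ℝ u v * x i v) =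
        G.adjMatrix ℝ u v * ∑ i, x i u * x i v := by
      rw [Finset.mul_sum]
      exact Finset.sum_congr rfl fun i _ => by ring
    rw [this, hx, SimpleGraph.adjMatrix_apply]
    by_cases h : G.Adj u v <;> by_cases h' : f u = f v <;> simp [h, h']
  rw [hl, hr] at hle
  have hdiv : ((k : ℝ) - 1) / k = 1 - 1 / k := by field_simp
  rw [hdiv]
  linarith
end

section
/- Let G be a simple graph of order n ≥ 1 and size m, let k ≥ 2, and let q_n(G) denote the smallest eigenvalue of the signless Laplacian matrix Q(G) = D(G) + A(G). Then the maximum k-cut of G satisfies mc_k(G) ≤ ((k−1)/k)·(2m − n·q_n(G)/2). -/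
open Finset

open Matrix in
/-- A real symmetric matrix whose eigenvalues are at least `c` dominates `c • 1`. -/
theorem Matrix.IsHermitian.posSemidef_sub_smul_one {ι : Type*} [Fintype ι] [DecidableEq ι]
    {A : Matrix ι ι ℝ} (hA : A.IsHermitian) {c : ℝ} (hc : ∀ i, c ≤ hA.eigenvalues i) :
    (A - c • (1 : Matrix ι ι ℝ)).PosSemidef := by
  have hB : (A - c • (1 : Matrix ι ι ℝ)).IsHermitian := by
    simp only [IsHermitian, conjTranspose_sub, conjTranspose_smul, conjTranspose_one, hA.eq,
      star_trivial]
  rw [hB.posSemidef_iff_eigenvalues_nonneg]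
  intro i
  have h := hB.eigenvalues_mem_spectrum_real i
  have h' : c + hB.eigenvalues i ∈ spectrum ℝ A := by
    rw [add_comm, spectrum.add_mem_iff]
    rwa [Algebra.algebraMap_eq_smul_one, neg_add_eq_sub]
  rw [hA.spectrum_real_eq_range_eigenvalues] at h'
  obtain ⟨j, hj⟩ := h'
  have := hc j
  simp only [Pi.zero_apply]
  linarith

/-- Gram matrix of the vectors `k • e_a - 1`, for `a` in `Fin k`. -/
theorem sum_indicator_sub_one_mul (k : ℕ) (a b : Fin k) :
    ∑ i : Fin k, ((k : ℝ) * (if a = i then 1 else 0) - 1) * (k * (if b = i then 1 else 0) - 1)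
      = k ^ 2 * (if a = b then 1 else 0) - k := by
  have h : ∀ i : Fin k,
      ((k : ℝ) * (if a = i then 1 else 0) - 1) * (k * (if b = i then 1 else 0) - 1)
      = k ^ 2 * (if a = i then (if b = i then 1 else 0) else 0) - k * (if a = i then 1 else 0)
        - k * (if b = i then 1 else 0) + 1 := by
    intro i
    split_ifs <;> ring
  rw [Finset.sum_congr rfl fun i _ => h i]
  simp only [Finset.sum_add_distrib, Finset.sum_sub_distrib, ← Finset.mul_sum,
    Finset.sum_ite_eq, Finset.mem_univ, if_true, Finset.sum_const, Finset.card_univ,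
    Fintype.card_fin, nsmul_eq_mul, eq_comm (a := b) (b := a)]
  ring

theorem SimpleGraph.sum_sum_adj_eq_two_mul_card_edgeFinset {V : Type*} [Fintype V]
    [DecidableEq V] (G : SimpleGraph V) [DecidableRel G.Adj] :
    ∑ u, ∑ v, (if G.Adj u v then (1 : ℝ) else 0) = 2 * (#G.edgeFinset : ℝ) := by
  have h := G.two_mul_card_edgeFinset
  rw [← Fintype.sum_prod_type' (f := fun u v => if G.Adj u v then (1 : ℝ) else 0),
    Finset.sum_boole]
  exact_mod_cast h.symm

/-- Twice the number of edges cut by `f` is the number of ordered adjacent pairs cut by `f`. -/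
theorem SimpleGraph.sum_sum_adj_and_ne_eq_two_mul_card {V W : Type*} [Fintype V] [DecidableEq V]
    [DecidableEq W] (G : SimpleGraph V) [DecidableRel G.Adj] (f : V → W) :
    ∑ u, ∑ v, (if G.Adj u v ∧ f u ≠ f v then (1 : ℝ) else 0)
      = 2 * (#{e ∈ G.edgeFinset | ¬ (e.map f).IsDiag} : ℝ) := by
  let H : SimpleGraph V :=
    { Adj := fun u v => G.Adj u v ∧ f u ≠ f v
      symm := ⟨fun _ _ h => ⟨h.1.symm, h.2.symm⟩⟩
      loopless := ⟨fun _ h => h.2 rfl⟩ }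
  have : DecidableRel H.Adj := fun u v => inferInstanceAs (Decidable (G.Adj u v ∧ f u ≠ f v))
  have hH : H.edgeFinset = {e ∈ G.edgeFinset | ¬ (e.map f).IsDiag} := by
    ext e
    induction e with | _ u v
    simp [H]
  rw [← hH, ← H.sum_sum_adj_eq_two_mul_card_edgeFinset]
  congr!

theorem sum_sum_signlessLap_sub_smul_one_mul {n : ℕ} (G : SimpleGraph (Fin n))
    [DecidableRel G.Adj] (c : ℝ) (w : Fin n → Fin n → ℝ) :
    ∑ u, ∑ v, (signlessLap G - c • (1 : Matrix (Fin n) (Fin n) ℝ)) u v * w u v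
      = ∑ u, (G.degree u - c) * w u u + ∑ u, ∑ v, (if G.Adj u v then 1 else 0) * w u v := by
  rw [← Finset.sum_add_distrib]
  refine Finset.sum_congr rfl fun u _ => ?_
  have h : ∀ v, (signlessLap G - c • (1 : Matrix (Fin n) (Fin n) ℝ)) u v * w u v
      = (if u = v then (G.degree u - c) * w u v else 0)
        + (if G.Adj u v then 1 else 0) * w u v := by
    intro v
    simp only [signlessLap, Matrix.sub_apply, Matrix.add_apply, Matrix.smul_apply,
      Matrix.diagonal_apply, Matrix.one_apply, SimpleGraph.adjMatrix_apply, smul_eq_mul]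
    split_ifs <;> ring
  simp only [h, Finset.sum_add_distrib, Finset.sum_ite_eq, Finset.mem_univ, if_true]

/-- The spectral bound for the number of edges cut by a single partition. -/
theorem card_cut_le_of_le_eigenvalues {n k : ℕ} (G : SimpleGraph (Fin n)) [DecidableRel G.Adj]
    (hk : 0 < k) (hQ : (signlessLap G).IsHermitian) {c : ℝ} (hc : ∀ i, c ≤ hQ.eigenvalues i)
    (f : Fin n → Fin k) :
    (#{e ∈ G.edgeFinset | ¬ (e.map f).IsDiag} : ℝ)
      ≤ (((k : ℝ) - 1) / k) * (2 * (#G.edgeFinset : ℝ) - n * c / 2) := by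
  have hps := hQ.posSemidef_sub_smul_one hc
  let x : Fin k → Fin n → ℝ := fun i v => k * (if f v = i then 1 else 0) - 1
  have hsum : 0 ≤ ∑ i, ∑ u, ∑ v,
      (signlessLap G - c • (1 : Matrix (Fin n) (Fin n) ℝ)) u v * (x i u * x i v) := by
    refine Finset.sum_nonneg fun i _ => ?_
    have h := hps.dotProduct_mulVec_nonneg (x i)
    simp only [dotProduct, Matrix.mulVec, Finset.mul_sum, star_trivial] at h
    refine h.trans_eq (Finset.sum_congr rfl fun u _ => Finset.sum_congr rfl fun v _ => ?_)
    ring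
  have hgram : ∀ u v, ∑ i, x i u * x i v = k ^ 2 * (if f u = f v then 1 else 0) - k :=
    fun u v => sum_indicator_sub_one_mul k (f u) (f v)
  rw [Finset.sum_comm] at hsum
  simp only [Finset.sum_comm (s := (univ : Finset (Fin k))), ← Finset.mul_sum, hgram] at hsum
  rw [sum_sum_signlessLap_sub_smul_one_mul] at hsum
  have hsplit : ∀ u v, (if G.Adj u v then (1 : ℝ) else 0)
        * (k ^ 2 * (if f u = f v then 1 else 0) - k)
      = (k ^ 2 - k) * (if G.Adj u v then 1 else 0)
        - k ^ 2 * (if G.Adj u v ∧ f u ≠ f v then 1 else 0) := by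
    intro u v
    by_cases h₁ : G.Adj u v <;> by_cases h₂ : f u = f v <;> simp [h₁, h₂]
  have hdeg : ∑ u, (G.degree u : ℝ) = 2 * (#G.edgeFinset : ℝ) := by
    exact_mod_cast G.sum_degrees_eq_twice_card_edges
  simp only [hsplit, if_true, Finset.sum_sub_distrib, ← Finset.mul_sum, ← Finset.sum_mul,
    G.sum_sum_adj_eq_two_mul_card_edgeFinset, G.sum_sum_adj_and_ne_eq_two_mul_card, hdeg,
    Finset.sum_const, Finset.card_univ, Fintype.card_fin, nsmul_eq_mul] at hsum
  have hk' : (0 : ℝ) < k := by exact_mod_cast hk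
  rw [div_mul_eq_mul_div, le_div_iff₀ hk']
  refine le_of_mul_le_mul_left ?_ hk'
  linarith

theorem stmt_11 {n : ℕ} (hn : 1 ≤ n) (G : SimpleGraph (Fin n)) [DecidableRel G.Adj]
    (k : ℕ) (hk : 2 ≤ k)
    (hQ : (signlessLap G).IsHermitian) :
    (maxKCut G k : ℝ) ≤ (((k : ℝ) - 1) / k) *
      (2 * (G.edgeFinset.card : ℝ)
        - (n : ℝ) * (Finset.univ.inf' (Finset.univ_nonempty_iff.mpr ⟨⟨0, hn⟩⟩)
            hQ.eigenvalues) / 2) := by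
  have : Nonempty (Fin n → Fin k) := ⟨fun _ => ⟨0, by omega⟩⟩
  obtain ⟨f, -, hf⟩ : ∃ f ∈ (Finset.univ : Finset (Fin n → Fin k)),
      maxKCut G k = #{e ∈ G.edgeFinset | ¬ (e.map f).IsDiag} :=
    Finset.exists_mem_eq_sup _ Finset.univ_nonempty _
  rw [hf]
  exact card_cut_le_of_le_eigenvalues G (by omega) hQ
    (fun i => Finset.inf'_le _ (Finset.mem_univ i)) f
end

section
/- Let G be a simple graph with vertex set V, let k ≥ 2, and let {S_1, ..., S_k} be a partition of V into k nonempty parts. For each i define the vector s^(i) indexed by V with entry −k+1 at vertices of S_i and entry 1 at all other vertices. Then s^(i) is an eigenvector of the adjacency matrix A(G) to the eigenvalue λ for every i ∈ {1,...,k} if and only if for every i, every vertex v ∈ S_i, and every j ≠ i with j ∈ {1,...,k}, one has d_v(S_i) − d_v(S_i,S_j) = λ. -/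
open Finset

/-- The degree of a vertex is the sum of its numbers of neighbors in the parts of a partition. -/
theorem sum_degIn_eq_degIn_univ {n k : ℕ} (G : SimpleGraph (Fin n)) [DecidableRel G.Adj]
    (S : Fin k → Finset (Fin n))
    (hdisj : ∀ i j, i ≠ j → Disjoint (S i) (S j))
    (hcover : ∀ v, ∃ i, v ∈ S i) (v : Fin n) :
    ∑ i, degIn G v (S i) = degIn G v univ := by
  have hunion : (univ : Finset (Fin n)) = univ.biUnion S := by
    ext u
    simpa using hcover u
  simp only [degIn]
  rw [hunion, filter_biUnion, card_biUnion]
  exact fun i _ j _ hij => disjoint_filter_filter (hdisj i j hij)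

/-- The adjacency matrix applied to the vector with value `-c + 1` on `X` and `1` elsewhere. -/
theorem adjMatrix_mulVec_ite {n : ℕ} (G : SimpleGraph (Fin n)) [DecidableRel G.Adj]
    (X : Finset (Fin n)) (c : ℝ) (v : Fin n) :
    (G.adjMatrix ℝ).mulVec (fun u => if u ∈ X then -c + 1 else 1) v
      = degIn G v univ - c * degIn G v X := by
  have hsplit : ∀ u, (if u ∈ X then -c + 1 else (1 : ℝ)) = 1 - c * if u ∈ X then 1 else 0 := by
    intro u
    split_ifs <;> ring
  have hinter : (univ.filter fun u => G.Adj v u).filter (· ∈ X)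
      = X.filter fun u => G.Adj v u := by
    ext u
    simp [and_comm]
  rw [SimpleGraph.adjMatrix_mulVec_apply, SimpleGraph.neighborFinset_eq_filter]
  simp_rw [hsplit]
  rw [sum_sub_distrib, ← mul_sum, sum_boole, hinter]
  simp [degIn]

theorem stmt_12 {n k : ℕ} (hk : 2 ≤ k) (G : SimpleGraph (Fin n)) [DecidableRel G.Adj]
    (S : Fin k → Finset (Fin n))
    (hdisj : ∀ i j, i ≠ j → Disjoint (S i) (S j))
    (hcover : ∀ v, ∃ i, v ∈ S i)
    (hne : ∀ i, (S i).Nonempty)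
    (s : Fin k → Fin n → ℝ)
    (hs : ∀ i v, s i v = if v ∈ S i then -(k : ℝ) + 1 else 1)
    (lam : ℝ) :
    (∀ i, s i ≠ 0 ∧ (G.adjMatrix ℝ).mulVec (s i) = lam • s i) ↔
      (∀ i, ∀ v ∈ S i, ∀ j, j ≠ i →
        (degIn G v (S i) : ℝ) - (degIn G v (S j) : ℝ) = lam) := by
  have hk0 : (k : ℝ) ≠ 0 := by positivity
  have hk2 : (2 : ℝ) ≤ k := by exact_mod_cast hk
  have hmul : ∀ i v, (G.adjMatrix ℝ).mulVec (s i) v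
      = degIn G v univ - k * degIn G v (S i) := by
    intro i v
    rw [funext (hs i), adjMatrix_mulVec_ite]
  have hnotMem : ∀ {i j v}, v ∈ S i → j ≠ i → v ∉ S j := fun hv hji hvj =>
    disjoint_left.mp (hdisj _ _ hji) hvj hv
  constructor
  · intro h i v hv j hji
    have hi := congrFun (h i).2 v
    have hj := congrFun (h j).2 v
    rw [hmul, Pi.smul_apply, smul_eq_mul, hs, if_pos hv] at hi
    rw [hmul, Pi.smul_apply, smul_eq_mul, hs, if_neg (hnotMem hv hji)] at hj
    apply mul_left_cancel₀ hk0
    linarith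
  · intro h i
    refine ⟨fun h0 => ?_, funext fun v => ?_⟩
    · obtain ⟨v, hv⟩ := hne i
      have := congrFun h0 v
      rw [hs, if_pos hv, Pi.zero_apply] at this
      linarith
    · obtain ⟨j, hv⟩ := hcover v
      have hdeg : (degIn G v univ : ℝ) = k * degIn G v (S j) - (k - 1) * lam := by
        have hparts : ∀ l, (degIn G v (S l) : ℝ)
            = (degIn G v (S j) - lam) + if l = j then lam else 0 := by
          intro l
          split_ifs with hl
          · rw [hl]
            ring
          · linarith [h j v hv l hl]
        rw [← sum_degIn_eq_degIn_univ G S hdisj hcover, Nat.cast_sum,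
          sum_congr rfl fun l _ => hparts l]
        simp only [sum_add_distrib, sum_const, card_univ, Fintype.card_fin, nsmul_eq_mul,
          sum_ite_eq', mem_univ, if_true]
        ring
      rw [hmul, Pi.smul_apply, smul_eq_mul, hs, hdeg]
      by_cases hij : i = j
      · subst hij
        rw [if_pos hv]
        ring
      · rw [if_neg (hnotMem hv hij), ← h j v hv i hij]
        ring
end
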